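/- A single point reassignment between clusters changes the Mass Agreement Score by at most 3/N: |U' − U| ≤ (3N − 2)/N² < 3/N. -/

import Mathlib

open Finset

theorem mas_aux_step (m b R : ℝ) (hb : 0 ≤ b) (hR : 0 ≤ R) (hbm : b ≤ m)
    (hR1 : R ≤ (m - b) ^ 2) :
    |(R + (b + 1) ^ 2) / (m + 1) - (R + b ^ 2) / m| ≤ 1 := by
  rcases eq_or_lt_of_le (hb.trans hbm) with h | h
  · subst h
    have hb0 : b = 0 := le_antisymm hbm hb
    subst hb0
    have : R = 0 := by nlinarith
    subst this
    norm_num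
  · have h1 : 0 < m + 1 := by linarith
    have e : (R + (b + 1) ^ 2) / (m + 1) - (R + b ^ 2) / m
        = (m * (2 * b + 1) - (R + b ^ 2)) / (m * (m + 1)) := by
      field_simp
      ring
    have hp : 0 < m * (m + 1) := by positivity
    rw [e, abs_le, le_div_iff₀ hp, div_le_iff₀ hp]
    constructor
    · nlinarith [mul_nonneg hb (sub_nonneg.2 hbm)]
    · nlinarith [sq_nonneg (m - b)]

theorem mas_aux_bound (N a b R : ℝ) (ha : 0 ≤ a) (hb : 0 ≤ b) (hR : 0 ≤ R) (hab : a + b ≤ N)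
    (hR1 : R ≤ (N - a - b) ^ 2) : |a - (R + b ^ 2) / (N - a)| ≤ N := by
  have h0 : 0 ≤ (R + b ^ 2) / (N - a) := div_nonneg (by positivity) (by linarith)
  have h1 : (R + b ^ 2) / (N - a) ≤ N - a := by
    apply div_le_of_le_mul₀ (by linarith) (by linarith)
    nlinarith [mul_nonneg hb (sub_nonneg.2 hab)]
  rw [abs_le]
  constructor <;> linarith

theorem mas_aux_abs (x y d : ℝ) (h : |x - y| ≤ d) : |(|x| - |y|)| ≤ d :=
  (abs_abs_sub_abs_le_abs_sub x y).trans h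

theorem mas_aux_sq {ι : Type*} (s : Finset ι) (f : ι → ℝ) (hf : ∀ i, 0 ≤ f i) :
    ∑ i ∈ s, f i ^ 2 ≤ (∑ i ∈ s, f i) ^ 2 := by
  rw [sq (∑ i ∈ s, f i), sum_mul]
  apply sum_le_sum
  intro i hi
  rw [sq]
  exact mul_le_mul_of_nonneg_left (single_le_sum (fun j _ => hf j) hi) (hf i)

/-- A single point reassignment between clusters changes the Mass Agreement Score by
at most `3 / N`: `|U' - U| ≤ (3 * N - 2) / N ^ 2 < 3 / N`. -/
theorem mas_single_move_stability (K N : ℕ) (hK : 2 ≤ K) (n : Fin K → ℕ)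
    (hsum : ∑ i, n i = N) (A B : Fin K) (hAB : A ≠ B) (hA : 1 ≤ n A)
    (n' : Fin K → ℕ)
    (hn' : n' = Function.update (Function.update n A (n A - 1)) B (n B + 1)) :
    |∑ i, ((n' i : ℝ) / N) *
        (1 - |(n' i : ℝ) - ((∑ j, (n' j : ℝ) ^ 2) - (n' i : ℝ) ^ 2) / ((N : ℝ) - n' i)| / N)
      - ∑ i, ((n i : ℝ) / N) *
        (1 - |(n i : ℝ) - ((∑ j, (n j : ℝ) ^ 2) - (n i : ℝ) ^ 2) / ((N : ℝ) - n i)| / N)|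
      ≤ (3 * (N : ℝ) - 2) / (N : ℝ) ^ 2 ∧
    (3 * (N : ℝ) - 2) / (N : ℝ) ^ 2 < 3 / N := by
  have hBA : B ≠ A := hAB.symm
  have split : ∀ f : Fin K → ℝ, ∑ i, f i = f A + (f B + ∑ i ∈ (univ.erase A).erase B, f i) := by
    intro f
    rw [add_sum_erase _ _ (by simp [hBA]), add_sum_erase _ _ (mem_univ A)]
  have hsumR : ∑ i, (n i : ℝ) = N := by exact_mod_cast hsum
  have hA1 : (1 : ℝ) ≤ n A := by exact_mod_cast hA
  have nn : ∀ i, (0 : ℝ) ≤ n i := fun i => Nat.cast_nonneg _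
  have hA' : (n' A : ℝ) = n A - 1 := by
    rw [hn', Function.update_of_ne hAB, Function.update_self]
    push_cast [hA]
    ring
  have hB' : (n' B : ℝ) = n B + 1 := by
    rw [hn', Function.update_self]
    push_cast
    ring
  have hO' : ∀ i, i ≠ A → i ≠ B → (n' i : ℝ) = n i := by
    intro i h1 h2
    rw [hn', Function.update_of_ne h2, Function.update_of_ne h1]
  set s := ((univ : Finset (Fin K)).erase A).erase B with hs
  have hmem : ∀ i, i ∈ s ↔ i ≠ A ∧ i ≠ B := by
    intro i
    simp [hs, and_comm]
  set R : ℝ := ∑ i ∈ s, (n i : ℝ) ^ 2 with hRdef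
  have hM : ∑ i ∈ s, (n i : ℝ) = N - n A - n B := by
    have := split (fun i => (n i : ℝ))
    linarith
  have hR0 : 0 ≤ R := sum_nonneg fun i _ => sq_nonneg _
  have hR1 : R ≤ ((N : ℝ) - n A - n B) ^ 2 := by
    rw [← hM]
    exact mas_aux_sq s _ nn
  have hab : (n A : ℝ) + n B ≤ N := by
    have : 0 ≤ ∑ i ∈ s, (n i : ℝ) := sum_nonneg fun i _ => nn i
    linarith
  have hoth : ∀ i ∈ s, (n A : ℝ) + n B + n i ≤ N := by
    intro i hi
    have := single_le_sum (f := fun i => (n i : ℝ)) (fun i _ => nn i) hi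
    linarith
  have hQ : ∑ j, (n j : ℝ) ^ 2 = R + (n A : ℝ) ^ 2 + (n B : ℝ) ^ 2 := by
    rw [split]
    ring
  have hQ' : ∑ j, (n' j : ℝ) ^ 2 = R + ((n A : ℝ) - 1) ^ 2 + ((n B : ℝ) + 1) ^ 2 := by
    rw [split, hA', hB', sum_congr rfl (g := fun i => (n i : ℝ) ^ 2)]
    · ring
    · intro i hi
      rw [hO' i ((hmem i).1 hi).1 ((hmem i).1 hi).2]
  rw [hQ, hQ']
  set x : Fin K → ℝ := fun i =>
    |(n i : ℝ) - (R + (n A : ℝ) ^ 2 + (n B : ℝ) ^ 2 - (n i : ℝ) ^ 2) / ((N : ℝ) - n i)| with hx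
  set y : Fin K → ℝ := fun i =>
    |(n' i : ℝ) - (R + ((n A : ℝ) - 1) ^ 2 + ((n B : ℝ) + 1) ^ 2 - (n' i : ℝ) ^ 2)
      / ((N : ℝ) - n' i)| with hy
  change |∑ i, ((n' i : ℝ) / N) * (1 - y i / N) - ∑ i, ((n i : ℝ) / N) * (1 - x i / N)| ≤ _ ∧ _
  have hN : (1 : ℝ) ≤ N := by linarith [nn B]
  have hNpos : (0 : ℝ) < N := by linarith
  have xA : x A ≤ N := by
    have := mas_aux_bound N (n A) (n B) R (nn A) (nn B) hR0 hab hR1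
    simp only [hx]
    convert this using 4
    ring
  have yB : y B ≤ N := by
    have := mas_aux_bound N (n B + 1) (n A - 1) R (by linarith [nn B]) (by linarith) hR0
      (by linarith) (by convert hR1 using 2; ring)
    simp only [hy, hB']
    convert this using 4
    ring
  have x0 : 0 ≤ x A := abs_nonneg _
  have y0 : 0 ≤ y B := abs_nonneg _
  have key : ∀ i, |x i - y i| ≤ 2 := by
    intro i
    apply mas_aux_abs
    by_cases h1 : i = A
    · subst h1
      rw [hA']
      have := mas_aux_step (N - n i) (n B) R (nn B) hR0 (by linarith) hR1
      rw [abs_le] at this ⊢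
      have e1 : R + (n i : ℝ) ^ 2 + (n B : ℝ) ^ 2 - (n i : ℝ) ^ 2 = R + (n B : ℝ) ^ 2 := by ring
      have e2 : R + ((n i : ℝ) - 1) ^ 2 + ((n B : ℝ) + 1) ^ 2 - ((n i : ℝ) - 1) ^ 2
        = R + ((n B : ℝ) + 1) ^ 2 := by ring
      have e3 : (N : ℝ) - (n i - 1) = N - n i + 1 := by ring
      rw [e1, e2, e3]
      constructor <;> linarith [this.1, this.2]
    by_cases h2 : i = B
    · subst h2
      rw [hB']
      have := mas_aux_step (N - (n i + 1)) (n A - 1) R (by linarith) hR0 (by linarith)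
        (by convert hR1 using 2; ring)
      rw [abs_le] at this ⊢
      have e1 : R + (n A : ℝ) ^ 2 + (n i : ℝ) ^ 2 - (n i : ℝ) ^ 2
        = R + ((n A : ℝ) - 1 + 1) ^ 2 := by ring
      have e2 : R + ((n A : ℝ) - 1) ^ 2 + ((n i : ℝ) + 1) ^ 2 - ((n i : ℝ) + 1) ^ 2
        = R + ((n A : ℝ) - 1) ^ 2 := by ring
      have e3 : (N : ℝ) - n i = N - (n i + 1) + 1 := by ring
      rw [e1, e2, e3]
      constructor <;> linarith [this.1, this.2]
    · rw [hO' i h1 h2]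
      have h3 := hoth i ((hmem i).2 ⟨h1, h2⟩)
      have hd : 0 < (N : ℝ) - n i := by linarith [nn B]
      have e : (n i : ℝ) - (R + (n A : ℝ) ^ 2 + (n B : ℝ) ^ 2 - (n i : ℝ) ^ 2) / ((N : ℝ) - n i)
        - ((n i : ℝ) - (R + ((n A : ℝ) - 1) ^ 2 + ((n B : ℝ) + 1) ^ 2 - (n i : ℝ) ^ 2)
          / ((N : ℝ) - n i)) = (2 * (n B - n A + 1)) / ((N : ℝ) - n i) := by
        field_simp
        ring
      rw [e, abs_le, le_div_iff₀ hd, div_le_iff₀ hd]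
      constructor <;> linarith [nn B]
  set c : Fin K → ℝ := fun i => (n i : ℝ) - if i = A then 1 else 0 with hc
  have c0 : ∀ i, 0 ≤ c i := by
    intro i
    by_cases h : i = A
    · subst h
      simp [hc, hA]
    · simp [hc, h]
  have cs : ∑ i, c i = N - 1 := by
    simp [hc, hsumR]
  have hn1 : ∀ i, (n i : ℝ) = c i + if i = A then 1 else 0 := by
    intro i
    simp [hc]
  have hn2 : ∀ i, (n' i : ℝ) = c i + if i = B then 1 else 0 := by
    intro i
    by_cases h1 : i = A
    · subst h1
      simp [hc, hA', hAB]
    by_cases h2 : i = B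
    · subst h2
      simp [hc, hB', hBA]
    · simp [hc, h1, h2, hO' i h1 h2]
  have hmain : ∑ i, ((n' i : ℝ) / N) * (1 - y i / N) - ∑ i, ((n i : ℝ) / N) * (1 - x i / N)
      = (∑ i, c i * (x i - y i) + (x A - y B)) / (N : ℝ) ^ 2 := by
    have hxA : x A - y B = ∑ i, ((if i = B then (N - y i) else 0)
        - (if i = A then (N - x i) else 0)) := by
      rw [sum_sub_distrib]
      simp
    rw [hxA, ← sum_add_distrib, ← sum_sub_distrib, sum_div]
    apply sum_congr rfl
    intro i _
    rw [hn1 i, hn2 i]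
    split_ifs <;> field_simp <;> ring
  have hbd : |∑ i, c i * (x i - y i)| ≤ 2 * (N - 1) := by
    calc |∑ i, c i * (x i - y i)| ≤ ∑ i, |c i * (x i - y i)| := abs_sum_le_sum_abs _ _
      _ ≤ ∑ i, c i * 2 := by
        apply sum_le_sum
        intro i _
        rw [abs_mul, abs_of_nonneg (c0 i)]
        exact mul_le_mul_of_nonneg_left (key i) (c0 i)
      _ = 2 * (N - 1) := by
        rw [← sum_mul, cs]
        ring
  constructor
  · rw [hmain, abs_div, abs_of_pos (a := (N : ℝ) ^ 2) (by positivity)]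
    apply div_le_div_of_nonneg_right _ (by positivity)
    rw [abs_le] at hbd ⊢
    constructor <;> linarith [hbd.1, hbd.2]
  · rw [div_lt_div_iff₀ (by positivity) hNpos]
    nlinarith
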